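/- arXiv:1804.03935 — 2 statements merged into one kernel-verified Lean document; each statement's English description precedes it below -/
import Mathlib

section
/- Let X be a Banach space and K a nonempty compact subset of X. Suppose there are constants C0 > 0, C1 ≥ 1, 0 ≤ μ ≤ 1/2 and s > μ such that d_n(K)_X ≤ C0·max(1,n)^{-s} for all n ≥ 0 and γ_n(X) ≤ C1·n^{μ} for all n ≥ 1. Then for every greedy sequence for K and every n ≥ 2, σ_n(K)_X ≤ C0·C1·2^{μ}·16^{s}·√(log₂(2n))·n^{-s+μ}, where log₂ denotes the binary logarithm. -/
open scoped BigOperators NNReal ENNReal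

noncomputable section

/-- The span of the first `n` elements of the sequence `f`. -/
def greedySpan {X : Type*} [NormedAddCommGroup X] [NormedSpace ℝ X]
    (f : ℕ → X) (n : ℕ) : Submodule ℝ X :=
  Submodule.span ℝ (f '' Set.Iio n)

/-- The `n`-th greedy error `σ_n = dist(f_n, V_n)`. For `n = 0` this is `‖f 0‖`. -/
def greedyErr {X : Type*} [NormedAddCommGroup X] [NormedSpace ℝ X]
    (f : ℕ → X) (n : ℕ) : ℝ :=
  Metric.infDist (f n) (greedySpan f n : Set X)

/-- `f` is a greedy sequence for `K`: each `f n` lies in `K` and maximizes the distance to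
`V_n = span{f_0,…,f_{n-1}}` among elements of `K` (for `n = 0`, `‖f 0‖ = max_{g∈K} ‖g‖`). -/
def IsGreedySeq {X : Type*} [NormedAddCommGroup X] [NormedSpace ℝ X]
    (K : Set X) (f : ℕ → X) : Prop :=
  ∀ n : ℕ, f n ∈ K ∧ ∀ g ∈ K, Metric.infDist g (greedySpan f n : Set X) ≤ greedyErr f n

/-- Kolmogorov `n`-width of a set `K ⊆ X`. -/
def kolWidth {X : Type*} [NormedAddCommGroup X] [NormedSpace ℝ X]
    (K : Set X) : ℕ → ℝ
  | 0 => ⨆ g ∈ K, ‖g‖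
  | (n+1) => ⨅ L : {L : Submodule ℝ X // Module.finrank ℝ L = n + 1},
      ⨆ g ∈ K, Metric.infDist g (L.1 : Set X)

/-- Kolmogorov `n`-width of a bounded linear operator `T : E → X`. -/
def kolWidthOp {E X : Type*} [NormedAddCommGroup E] [NormedSpace ℝ E]
    [NormedAddCommGroup X] [NormedSpace ℝ X] (T : E →L[ℝ] X) : ℕ → ℝ
  | 0 => ‖T‖
  | (n+1) => ⨅ L : {L : Submodule ℝ X // Module.finrank ℝ L = n + 1},
      ⨆ x : {x : E // ‖x‖ ≤ 1}, Metric.infDist (T x.1) (L.1 : Set X)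

/-- Gelfand `n`-width of a bounded linear operator `T : E → X`. -/
def gelfandWidthOp {E X : Type*} [NormedAddCommGroup E] [NormedSpace ℝ E]
    [NormedAddCommGroup X] [NormedSpace ℝ X] (T : E →L[ℝ] X) : ℕ → ℝ
  | 0 => ‖T‖
  | (n+1) => ⨅ L : {L : Submodule ℝ E // IsClosed (L : Set E) ∧
        FiniteDimensional ℝ (E ⧸ L) ∧ Module.finrank ℝ (E ⧸ L) ≤ n + 1},
      ⨆ x : {x : E // x ∈ L.1 ∧ ‖x‖ ≤ 1}, ‖T x.1‖

/-- The `n`-th Grothendieck number of a bounded linear operator `T : X → Y`. -/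
def grothOp {X Y : Type*} [NormedAddCommGroup X] [NormedSpace ℝ X]
    [NormedAddCommGroup Y] [NormedSpace ℝ Y] (T : X →L[ℝ] Y) (n : ℕ) : ℝ :=
  ⨆ p : (Fin n → {x : X // ‖x‖ ≤ 1}) × (Fin n → {b : Y →L[ℝ] ℝ // ‖b‖ ≤ 1}),
    |Matrix.det (Matrix.of fun i j => (p.2 j).1 (T (p.1 i).1))| ^ ((1 : ℝ) / n)

/-- The `n`-th Grothendieck number of the Banach space `X`. -/
def groth (X : Type*) [NormedAddCommGroup X] [NormedSpace ℝ X] (n : ℕ) : ℝ :=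
  grothOp (ContinuousLinearMap.id ℝ X) n

/-- Banach–Mazur distance between two normed spaces. -/
def bmDist (X Y : Type*) [NormedAddCommGroup X] [NormedSpace ℝ X]
    [NormedAddCommGroup Y] [NormedSpace ℝ Y] : ℝ :=
  ⨅ T : X ≃L[ℝ] Y, ‖(T : X →L[ℝ] Y)‖ * ‖(T.symm : Y →L[ℝ] X)‖

/-- `γ_n(X)`: supremum of Banach–Mazur distances of `n`-dimensional subspaces of `X`
to `n`-dimensional Euclidean space. -/
def gammaBM (X : Type*) [NormedAddCommGroup X] [NormedSpace ℝ X] (n : ℕ) : ℝ :=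
  ⨆ V : {V : Submodule ℝ X // Module.finrank ℝ V = n},
    bmDist V.1 (EuclideanSpace ℝ (Fin n))

/-- `T` satisfies the absolutely 2-summing inequality with constant `C`. -/
def Summing2Bound {X Y : Type*} [NormedAddCommGroup X] [NormedSpace ℝ X]
    [NormedAddCommGroup Y] [NormedSpace ℝ Y] (T : X →L[ℝ] Y) (C : ℝ) : Prop :=
  ∀ (N : ℕ) (x : Fin N → X),
    (∑ i, ‖T (x i)‖ ^ 2) ^ ((1 : ℝ) / 2) ≤
      C * ⨆ b : {b : X →L[ℝ] ℝ // ‖b‖ ≤ 1}, (∑ i, (b.1 (x i)) ^ 2) ^ ((1 : ℝ) / 2)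

/-- `T` is absolutely 2-summing. -/
def IsSumming2 {X Y : Type*} [NormedAddCommGroup X] [NormedSpace ℝ X]
    [NormedAddCommGroup Y] [NormedSpace ℝ Y] (T : X →L[ℝ] Y) : Prop :=
  ∃ C : ℝ, 0 ≤ C ∧ Summing2Bound T C

/-- The 2-summing norm `‖T | B₂‖`. -/
def summing2Norm {X Y : Type*} [NormedAddCommGroup X] [NormedSpace ℝ X]
    [NormedAddCommGroup Y] [NormedSpace ℝ Y] (T : X →L[ℝ] Y) : ℝ :=
  sInf {C : ℝ | 0 ≤ C ∧ Summing2Bound T C}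

end

open scoped InnerProductSpace in
/-- If each `x i` stays at distance at least `a > 0` from the span of its predecessors, then the
parallelepiped spanned by the `x i` has volume at least `a ^ n`. -/
theorem pow_le_abs_det_of_le_norm_sub {H : Type*} [NormedAddCommGroup H] [InnerProductSpace ℝ H]
    {n : ℕ} (hn : Module.finrank ℝ H = n) [FiniteDimensional ℝ H] (b : OrthonormalBasis (Fin n) ℝ H)
    (x : Fin n → H) {a : ℝ} (ha : 0 < a)
    (hx : ∀ i, ∀ y ∈ Submodule.span ℝ (x '' Set.Iio i), a ≤ ‖x i - y‖) :
    a ^ n ≤ |b.toBasis.det x| := by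
  have hdim : Module.finrank ℝ H = Fintype.card (Fin n) := by simpa using hn
  have : Fact (Module.finrank ℝ H = n) := ⟨hn⟩
  have hgs : ∀ i, a ≤ ‖InnerProductSpace.gramSchmidt ℝ x i‖ := fun i => by
    rw [InnerProductSpace.gramSchmidt_def]
    refine hx i _ ?_
    rw [← InnerProductSpace.span_gramSchmidt_Iio ℝ x i]
    refine Submodule.sum_mem _ fun j hj => ?_
    rw [Submodule.starProjection_singleton]
    exact Submodule.smul_mem _ _ (Submodule.subset_span ⟨j, by simpa using hj, rfl⟩)
  have hinner : ∀ i, ⟪InnerProductSpace.gramSchmidtOrthonormalBasis hdim x i, x i⟫_ℝ =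
      ‖InnerProductSpace.gramSchmidt ℝ x i‖ := fun i => by
    have hne : ‖InnerProductSpace.gramSchmidt ℝ x i‖ ≠ 0 := (ha.trans_le (hgs i)).ne'
    have hxi : ⟪InnerProductSpace.gramSchmidt ℝ x i, x i⟫_ℝ =
        ‖InnerProductSpace.gramSchmidt ℝ x i‖ ^ 2 := by
      conv_lhs => rw [InnerProductSpace.gramSchmidt_def'' ℝ x i]
      rw [inner_add_right, real_inner_self_eq_norm_sq, inner_sum, Finset.sum_eq_zero, add_zero]
      intro j hj
      rw [inner_smul_right, InnerProductSpace.gramSchmidt_orthogonal ℝ x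
        (Finset.mem_Iio.1 hj).ne', mul_zero]
    have hgn : InnerProductSpace.gramSchmidtNormed ℝ x i ≠ 0 := by
      simpa [InnerProductSpace.gramSchmidtNormed] using hne
    rw [InnerProductSpace.gramSchmidtOrthonormalBasis_apply hdim hgn,
      InnerProductSpace.gramSchmidtNormed, inner_smul_left, hxi]
    simp only [RCLike.ofReal_real_eq_id, id, map_inv₀, conj_trivial]
    field_simp
  have o : Orientation ℝ H (Fin n) := b.toBasis.orientation
  rw [← o.volumeForm_robust' b, o.volumeForm_robust'
    (InnerProductSpace.gramSchmidtOrthonormalBasis hdim x),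
    InnerProductSpace.gramSchmidtOrthonormalBasis_det, Finset.abs_prod]
  calc a ^ n = ∏ _i : Fin n, a := by simp
    _ ≤ _ := Finset.prod_le_prod (fun _ _ => ha.le) fun i _ => by
      rw [hinner, abs_norm]
      exact hgs i

open scoped InnerProductSpace in
/-- A weighted Hadamard inequality: if all vectors `x i` lie in the ellipsoid with semi-axes
`R * w j` along the orthonormal basis `b`, then their determinant is at most `R ^ n * ∏ j, w j`. -/
theorem abs_det_le_prod_mul_pow {H : Type*} [NormedAddCommGroup H] [InnerProductSpace ℝ H]
    {n : ℕ} (hn : Module.finrank ℝ H = n) (b : OrthonormalBasis (Fin n) ℝ H)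
    (x : Fin n → H) (w : Fin n → ℝ) (hw : ∀ j, 0 < w j) {R : ℝ} (hR : 0 ≤ R)
    (hx : ∀ i, ∑ j, (⟪b j, x i⟫_ℝ / w j) ^ 2 ≤ R ^ 2) :
    |b.toBasis.det x| ≤ (∏ j, w j) * R ^ n := by
  have : Fact (Module.finrank ℝ H = n) := ⟨hn⟩
  let D : H →ₗ[ℝ] H := Matrix.toLin b.toBasis b.toBasis (Matrix.diagonal w)
  let u : Fin n → H := fun i => ∑ j, (⟪b j, x i⟫_ℝ / w j) • b j
  have hDb : ∀ j, D (b j) = w j • b j := fun j => by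
    have := Matrix.toLin_self b.toBasis b.toBasis (Matrix.diagonal w) j
    simp only [OrthonormalBasis.coe_toBasis, Matrix.diagonal_apply, ite_smul, zero_smul] at this
    simpa [D] using this
  have hDu : D ∘ u = x := by
    ext i
    simp only [Function.comp, u, map_sum, map_smul, hDb, smul_smul]
    simp_rw [div_mul_cancel₀ _ (hw _).ne']
    exact b.sum_repr' (x i)
  have hu : ∀ i, ‖u i‖ ≤ R := fun i => by
    refine abs_le_of_sq_le_sq' ?_ hR |>.2
    have hrepr : ∀ j, ⟪b j, u i⟫_ℝ = ⟪b j, x i⟫_ℝ / w j := fun j => by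
      simp only [u]
      exact b.orthonormal.inner_right_fintype _ j
    rw [← b.sum_sq_inner_right]
    simpa only [hrepr] using hx i
  have o : Orientation ℝ H (Fin n) := b.toBasis.orientation
  have hdet : LinearMap.det D = ∏ j, w j := by
    rw [LinearMap.det_toLin, Matrix.det_diagonal]
  have hvol : |b.toBasis.det u| ≤ R ^ n := by
    rw [← o.volumeForm_robust' b]
    refine (o.abs_volumeForm_apply_le u).trans ?_
    calc ∏ i, ‖u i‖ ≤ ∏ _i : Fin n, R := Finset.prod_le_prod (fun _ _ => norm_nonneg _)
          fun i _ => hu i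
      _ = R ^ n := by simp
  have hpos : 0 ≤ ∏ j, w j := Finset.prod_nonneg fun j _ => (hw j).le
  rw [← hDu, b.toBasis.det_comp, hdet, abs_mul, abs_of_nonneg hpos]
  exact mul_le_mul_of_nonneg_left hvol hpos

/-- There is a basis whose coordinate functionals have norm at most one on a normed space of
finite dimension, with basis vectors in the unit ball (an Auerbach basis). -/
theorem exists_auerbach_basis {V : Type*} [NormedAddCommGroup V] [NormedSpace ℝ V]
    [FiniteDimensional ℝ V] {n : ℕ} (hn : Module.finrank ℝ V = n) :
    ∃ v : Module.Basis (Fin n) ℝ V, (∀ i, ‖v i‖ ≤ 1) ∧ ∀ i x, |v.coord i x| ≤ ‖x‖ := by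
  let e : Module.Basis (Fin n) ℝ V := Module.finBasisOfFinrankEq ℝ V hn
  let B : Set (Fin n → V) := Set.pi Set.univ fun _ => Metric.closedBall 0 1
  have hB : IsCompact B := isCompact_univ_pi fun _ => isCompact_closedBall 0 1
  have hcont : Continuous fun v : Fin n → V => |e.det v| := by
    refine continuous_abs.comp ?_
    have : ⇑e.det = fun v : Fin n → V => (e.toMatrix v).det := by
      ext v; rw [e.det_apply]
    rw [this]
    refine Continuous.matrix_det ?_
    refine continuous_matrix fun i j => ?_
    exact (LinearMap.continuous_of_finiteDimensional (e.coord i)).comp (continuous_apply j)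
  obtain ⟨v, hvB, hmax⟩ := hB.exists_isMaxOn ⟨0, by simp [B]⟩ hcont.continuousOn
  have hmem : ∀ {u : Fin n → V}, (∀ i, ‖u i‖ ≤ 1) → u ∈ B := fun hu => by
    simpa [B, Set.mem_pi] using hu
  have hv1 : ∀ i, ‖v i‖ ≤ 1 := by simpa [B, Set.mem_pi] using hvB
  have hpos : 0 < |e.det v| := by
    let u : Fin n → V := fun i => ‖e i‖⁻¹ • e i
    have hu : u ∈ B := hmem fun i => by
      simp only [u, norm_smul, norm_inv, norm_norm]
      exact inv_mul_le_one
    refine lt_of_lt_of_le ?_ (hmax hu)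
    have : e.det u = ∏ i, ‖e i‖⁻¹ := by
      simp only [u]
      rw [AlternatingMap.map_smul_univ, e.det_self, smul_eq_mul, mul_one]
    simp only [this, abs_pos]
    exact Finset.prod_ne_zero_iff.2 fun i _ => inv_ne_zero (norm_ne_zero_iff.2 (e.ne_zero i))
  obtain ⟨hli, hsp⟩ := e.is_basis_iff_det.2 (isUnit_iff_ne_zero.2 (abs_pos.1 hpos))
  refine ⟨Module.Basis.mk hli hsp.ge, by simpa using hv1, fun i x => ?_⟩
  have hball : ∀ y : V, ‖y‖ ≤ 1 → |(Module.Basis.mk hli hsp.ge).coord i y| ≤ 1 := fun y hy => by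
    have hc := LinearMap.congr_fun (e.det_smul_mk_coord_eq_det_update hli hsp.ge i) y
    simp only [LinearMap.smul_apply, smul_eq_mul, MultilinearMap.toLinearMap_apply] at hc
    have hup : |e.det (Function.update v i y)| ≤ |e.det v| := hmax <| hmem fun j => by
      rcases eq_or_ne j i with rfl | hj
      · simpa using hy
      · simpa [hj] using hv1 j
    have : |e.det v| * |(Module.Basis.mk hli hsp.ge).coord i y| ≤ |e.det v| := by
      rw [← abs_mul, hc]; exact hup
    nlinarith
  rcases eq_or_ne x 0 with rfl | hx
  · simp only [map_zero, abs_zero, norm_zero, le_refl]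
  have hx' : 0 < ‖x‖ := norm_pos_iff.2 hx
  have := hball (‖x‖⁻¹ • x) (by rw [norm_smul, norm_inv, norm_norm, inv_mul_cancel₀ hx'.ne'])
  rw [map_smul, smul_eq_mul, abs_mul, abs_inv, abs_norm, inv_mul_le_iff₀ hx', mul_one] at this
  exact this

theorem bmDist_le_sq {V : Type*} [NormedAddCommGroup V] [NormedSpace ℝ V]
    [FiniteDimensional ℝ V] {n : ℕ} (hn : Module.finrank ℝ V = n) :
    bmDist V (EuclideanSpace ℝ (Fin n)) ≤ (n : ℝ) * n := by
  obtain ⟨v, hv, hcoord⟩ := exists_auerbach_basis hn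
  let T : V ≃L[ℝ] EuclideanSpace ℝ (Fin n) :=
    (v.equivFun.trans (WithLp.linearEquiv 2 ℝ (Fin n → ℝ)).symm).toContinuousLinearEquiv
  have hT : ‖(T : V →L[ℝ] EuclideanSpace ℝ (Fin n))‖ ≤ n := by
    refine ContinuousLinearMap.opNorm_le_bound _ (by positivity) fun x => ?_
    have hTx : ∀ i, T x i = v.coord i x := fun i => rfl
    rw [ContinuousLinearEquiv.coe_coe, EuclideanSpace.norm_eq]
    refine Real.sqrt_le_iff.2 ⟨by positivity, ?_⟩
    calc ∑ i, ‖T x i‖ ^ 2 ≤ ∑ _i : Fin n, ‖x‖ ^ 2 := Finset.sum_le_sum fun i _ => by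
          rw [hTx, Real.norm_eq_abs]
          exact pow_le_pow_left₀ (abs_nonneg _) (hcoord i x) 2
      _ = n * ‖x‖ ^ 2 := by simp
      _ ≤ (n * ‖x‖) ^ 2 := by
          rw [mul_pow]
          gcongr
          exact_mod_cast Nat.le_self_pow two_ne_zero n
  have hTs : ‖(T.symm : EuclideanSpace ℝ (Fin n) →L[ℝ] V)‖ ≤ n := by
    refine ContinuousLinearMap.opNorm_le_bound _ (by positivity) fun y => ?_
    have hTy : T.symm y = ∑ i, y i • v i := v.equivFun_symm_apply _
    rw [ContinuousLinearEquiv.coe_coe, hTy]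
    calc ‖∑ i, y i • v i‖ ≤ ∑ _i : Fin n, ‖y‖ := norm_sum_le_of_le _ fun i _ => by
          rw [norm_smul]
          exact (mul_le_of_le_one_right (norm_nonneg _) (hv i)).trans (PiLp.norm_apply_le y i)
      _ = n * ‖y‖ := by simp
  refine (ciInf_le ⟨0, ?_⟩ T).trans (mul_le_mul hT hTs (norm_nonneg _) (by positivity))
  rintro _ ⟨S, rfl⟩
  positivity

theorem bmDist_le_gammaBM {X : Type*} [NormedAddCommGroup X] [NormedSpace ℝ X]
    {n : ℕ} (hn : 1 ≤ n) (V : Submodule ℝ X) (hV : Module.finrank ℝ V = n) :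
    bmDist V (EuclideanSpace ℝ (Fin n)) ≤ gammaBM X n := by
  refine le_ciSup (f := fun V : {V : Submodule ℝ X // Module.finrank ℝ V = n} =>
    bmDist V.1 (EuclideanSpace ℝ (Fin n))) ⟨(n : ℝ) * n, ?_⟩ ⟨V, hV⟩
  rintro _ ⟨⟨U, hU⟩, rfl⟩
  have : FiniteDimensional ℝ U := Module.finite_of_finrank_pos (by omega)
  exact bmDist_le_sq hU

theorem exists_continuousLinearEquiv_of_bmDist_lt {V : Type*} [NormedAddCommGroup V]
    [NormedSpace ℝ V] [FiniteDimensional ℝ V] {n : ℕ} (hn : Module.finrank ℝ V = n) {G : ℝ}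
    (hG : bmDist V (EuclideanSpace ℝ (Fin n)) < G) :
    ∃ T : V ≃L[ℝ] EuclideanSpace ℝ (Fin n), ‖(T : V →L[ℝ] EuclideanSpace ℝ (Fin n))‖ *
      ‖(T.symm : EuclideanSpace ℝ (Fin n) →L[ℝ] V)‖ < G := by
  have : Nonempty (V ≃L[ℝ] EuclideanSpace ℝ (Fin n)) :=
    ⟨ContinuousLinearEquiv.ofFinrankEq (by simpa using hn)⟩
  exact exists_lt_of_ciInf_lt hG

theorem linearIndependent_of_notMem_span_image_Iio {E : Type*} [AddCommGroup E] [Module ℝ E]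
    {n : ℕ} (x : ℕ → E) (hx : ∀ i < n, x i ∉ Submodule.span ℝ (x '' Set.Iio i)) :
    LinearIndependent ℝ fun i : Fin n => x i := by
  induction n with
  | zero => exact linearIndependent_empty_type
  | succ n ih =>
    rw [linearIndependent_finSucc']
    refine ⟨ih fun i hi => hx i (hi.trans n.lt_succ_self), ?_⟩
    have hrange : Set.range (Fin.init fun i : Fin (n + 1) => x i) = x '' Set.Iio n := by
      ext y
      constructor
      · rintro ⟨i, rfl⟩
        exact ⟨i, i.2, rfl⟩
      · rintro ⟨i, hi, rfl⟩
        exact ⟨⟨i, hi⟩, rfl⟩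
    rw [hrange]
    exact hx n n.lt_succ_self

theorem prod_four_div_rpow_le {n : ℕ} (hn : 1 ≤ n) {s : ℝ} (hs : 0 ≤ s) :
    ∏ j : Fin n, (4 / ((j : ℝ) + 1)) ^ s ≤ ((16 : ℝ) ^ s * (n : ℝ) ^ (-s)) ^ n := by
  have hn0 : (0 : ℝ) < n := by exact_mod_cast hn
  have hfac : ∏ j : Fin n, (4 / ((j : ℝ) + 1)) = 4 ^ n / (n.factorial : ℝ) := by
    rw [Fin.prod_univ_eq_prod_range (fun j : ℕ => 4 / ((j : ℝ) + 1)), Finset.prod_div_distrib,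
      ← Finset.prod_range_add_one_eq_factorial]
    push_cast
    simp
  have hexp : (n : ℝ) ^ n ≤ 4 ^ n * n.factorial := by
    have h := Real.pow_div_factorial_le_exp (n : ℝ) hn0.le n
    rw [div_le_iff₀ (by positivity), ← Real.exp_one_pow] at h
    refine h.trans ?_
    gcongr
    linarith [Real.exp_one_lt_d9]
  rw [Real.finsetProd_rpow _ _ fun j _ => by positivity, hfac, Real.rpow_neg hn0.le,
    ← div_eq_mul_inv, ← Real.div_rpow (by norm_num) hn0.le, Real.rpow_pow_comm (by positivity)]
  refine Real.rpow_le_rpow (by positivity) ?_ hs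
  rw [div_pow, div_le_div_iff₀ (by positivity) (by positivity)]
  calc (4 : ℝ) ^ n * n ^ n ≤ 4 ^ n * (4 ^ n * n.factorial) := by gcongr
    _ = 16 ^ n * n.factorial := by rw [← mul_assoc, ← mul_pow]; norm_num

open scoped InnerProductSpace in
/-- Vectors in an inner product space that are well approximated by subspaces of dimension
`2 ^ k` at the rate `2 ^ (-s k)` cannot all be far from the span of their predecessors. -/
theorem le_of_dyadic_approx {E : Type*} [NormedAddCommGroup E] [InnerProductSpace ℝ E]
    {n : ℕ} (hn : 1 ≤ n) (x : ℕ → E) (ξ : ℕ → ℕ → E) {a C s : ℝ} (ha : 0 < a) (hC : 0 < C)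
    (hs : 0 ≤ s)
    (hx : ∀ i < n, ∀ y ∈ Submodule.span ℝ (x '' Set.Iio i), a ≤ ‖x i - y‖)
    (hx0 : ∀ i < n, ‖x i‖ ≤ C)
    (hξ : ∀ k, 2 ^ (k + 1) ≤ n → ∀ i < n, ∃ l ∈ Submodule.span ℝ (ξ k '' Set.Iio (2 ^ k)),
      ‖x i - l‖ ≤ C * (2 ^ k : ℝ) ^ (-s)) :
    a ≤ C * (16 : ℝ) ^ s * Real.sqrt (Nat.log 2 n + 1) * (n : ℝ) ^ (-s) := by
  have hli : LinearIndependent ℝ fun i : Fin n => x i :=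
    linearIndependent_of_notMem_span_image_Iio x fun i hi hmem => by
      have := hx i hi _ hmem
      rw [sub_self, norm_zero] at this
      linarith
  let H : Submodule ℝ E := Submodule.span ℝ (Set.range fun i : Fin n => x i)
  have hH : Module.finrank ℝ H = n := by simpa using finrank_span_eq_card hli
  have : FiniteDimensional ℝ H := FiniteDimensional.span_of_finite ℝ (Set.finite_range _)
  have hdim : Module.finrank ℝ H = Fintype.card (Fin n) := by simpa using hH
  let x' : Fin n → H := fun i => ⟨x i, Submodule.subset_span ⟨i, rfl⟩⟩
  let P : E →L[ℝ] H := H.orthogonalProjectionOnto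
  let v : Fin n → H := fun j =>
    P (ξ (Nat.log 2 (j + 1)) (j + 1 - 2 ^ Nat.log 2 (j + 1)))
  let b := InnerProductSpace.gramSchmidtOrthonormalBasis hdim v
  let w : Fin n → ℝ := fun j => C * (4 / ((j : ℝ) + 1)) ^ s
  have hw : ∀ j, 0 < w j := fun j => by positivity
  have horth : ∀ (k : ℕ) (l : E), l ∈ Submodule.span ℝ (ξ k '' Set.Iio (2 ^ k)) →
      ∀ j : Fin n, Nat.log 2 (j + 1) = k + 1 → ⟪b j, P l⟫_ℝ = 0 := fun k l hl j hj => by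
    have hle : Submodule.span ℝ (ξ k '' Set.Iio (2 ^ k)) ≤
        LinearMap.ker ((innerSL ℝ (b j)).comp P).toLinearMap := by
      rw [Submodule.span_le]
      rintro _ ⟨r, hr, rfl⟩
      have hr : r < 2 ^ k := hr
      have hjk : 2 ^ (k + 1) ≤ (j : ℕ) + 1 := hj ▸ Nat.pow_log_le_self 2 (by omega)
      have hlt : 2 ^ k + r - 1 < (j : ℕ) := by
        have := Nat.one_le_two_pow (n := k)
        rw [pow_succ] at hjk
        omega
      have hsucc : 2 ^ k + r - 1 + 1 = 2 ^ k + r := by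
        have := Nat.one_le_two_pow (n := k)
        omega
      have hlog : Nat.log 2 (2 ^ k + r) = k :=
        (Nat.log_eq_iff (Or.inr ⟨by norm_num, by positivity⟩)).2
          ⟨by omega, by rw [pow_succ]; omega⟩
      have hv : v ⟨2 ^ k + r - 1, hlt.trans j.2⟩ = P (ξ k r) := by
        simp only [v, hsucc, hlog, Nat.add_sub_cancel_left]
      have h0 := InnerProductSpace.gramSchmidtOrthonormalBasis_inv_triangular hdim v
        (i := ⟨2 ^ k + r - 1, hlt.trans j.2⟩) (j := j) hlt
      rw [hv] at h0
      simpa using h0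
    simpa using hle hl
  have hblock : ∀ (i : Fin n) (k : ℕ) (W : ℝ) (z : H), 0 < W → ‖x' i - z‖ ≤ W →
      (∀ j : Fin n, Nat.log 2 (j + 1) = k → ⟪b j, z⟫_ℝ = 0 ∧ W ≤ w j) →
      ∑ j ∈ Finset.univ.filter fun j : Fin n => Nat.log 2 ((j : ℕ) + 1) = k,
           (⟪b j, x' i⟫_ℝ / w j) ^ 2 ≤ 1 := by
    intro i k W z hW hz hj
    calc ∑ j ∈ Finset.univ.filter fun j : Fin n => Nat.log 2 ((j : ℕ) + 1) = k,
           (⟪b j, x' i⟫_ℝ / w j) ^ 2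
        ≤ ∑ j ∈ Finset.univ.filter fun j : Fin n => Nat.log 2 ((j : ℕ) + 1) = k,
           ⟪b j, x' i - z⟫_ℝ ^ 2 / W ^ 2 := by
          refine Finset.sum_le_sum fun j hjk => ?_
          obtain ⟨h0, hWw⟩ := hj j (by simpa using hjk)
          rw [inner_sub_right, h0, sub_zero, div_pow]
          gcongr
      _ ≤ ∑ j, ⟪b j, x' i - z⟫_ℝ ^ 2 / W ^ 2 :=
          Finset.sum_le_univ_sum_of_nonneg fun j => by positivity
      _ = ‖x' i - z‖ ^ 2 / W ^ 2 := by rw [← Finset.sum_div, b.sum_sq_inner_right]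
      _ ≤ 1 := by
          rw [div_le_one (by positivity)]
          gcongr
  have hsum : ∀ i, ∑ j, (⟪b j, x' i⟫_ℝ / w j) ^ 2 ≤ Real.sqrt (Nat.log 2 n + 1) ^ 2 := by
    intro i
    rw [Real.sq_sqrt (by positivity), ← Finset.sum_fiberwise_of_maps_to
      (t := Finset.range (Nat.log 2 n + 1)) (g := fun j : Fin n => Nat.log 2 ((j : ℕ) + 1))
      fun j _ => Finset.mem_range.2 (Nat.lt_succ_of_le (Nat.log_mono_right j.2))]
    refine (Finset.sum_le_card_nsmul _ _ 1 fun k hk => ?_).trans (by simp)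
    have hkn : k ≤ Nat.log 2 n := Nat.lt_succ_iff.1 (Finset.mem_range.1 hk)
    rcases k with - | k
    · refine hblock i 0 C 0 hC (by simpa [x'] using hx0 i i.2) fun j hj => ⟨inner_zero_right _, ?_⟩
      have hj0 : (j : ℕ) = 0 := by
        have := Nat.log_eq_zero_iff.1 hj
        omega
      refine le_mul_of_one_le_right hC.le (Real.one_le_rpow ?_ hs)
      rw [hj0]
      norm_num
    · obtain ⟨l, hl, hxl⟩ := hξ k (Nat.pow_le_of_le_log (by omega) hkn) i i.2
      refine hblock i (k + 1) (C * (2 ^ k : ℝ) ^ (-s)) (P l) (by positivity) ?_ fun j hj =>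
        ⟨horth k l hl j hj, ?_⟩
      · have hPx : P (x i) = x' i := H.orthogonalProjectionOnto_mem_subspace_eq_self (x' i)
        rw [← hPx, ← map_sub]
        exact (H.norm_orthogonalProjectionOnto_apply_le _).trans hxl
      · have hjk : ((j : ℕ) + 1 : ℝ) < 2 ^ k * 4 := by
          have := hj ▸ Nat.lt_pow_succ_log_self (b := 2) (by norm_num) ((j : ℕ) + 1)
          calc ((j : ℕ) + 1 : ℝ) < 2 ^ (k + 1 + 1) := by exact_mod_cast this
            _ = 2 ^ k * 4 := by ring
        refine mul_le_mul_of_nonneg_left ?_ hC.le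
        rw [Real.rpow_neg (by positivity), ← Real.inv_rpow (by positivity)]
        refine Real.rpow_le_rpow (by positivity) ?_ hs
        rw [inv_le_comm₀ (by positivity) (by positivity), inv_div, div_le_iff₀ (by norm_num)]
        exact hjk.le
  have hdist : ∀ i, ∀ y ∈ Submodule.span ℝ (x' '' Set.Iio i), a ≤ ‖x' i - y‖ := by
    intro i y hy
    refine hx i i.2 y ?_
    have hmap := Submodule.mem_map_of_mem (f := H.subtype) hy
    rw [Submodule.map_span, ← Set.image_comp] at hmap
    refine Submodule.span_mono ?_ hmap
    rintro _ ⟨j, hj, rfl⟩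
    exact ⟨j, hj, rfl⟩
  have hvol := (pow_le_abs_det_of_le_norm_sub hH b x' ha hdist).trans
    (abs_det_le_prod_mul_pow hH b x' w hw (Real.sqrt_nonneg _) hsum)
  refine le_of_pow_le_pow_left₀ (n := n) (by omega) (by positivity) (hvol.trans ?_)
  calc (∏ j, w j) * Real.sqrt (Nat.log 2 n + 1) ^ n
      = C ^ n * (∏ j : Fin n, (4 / ((j : ℝ) + 1)) ^ s) * Real.sqrt (Nat.log 2 n + 1) ^ n := by
        simp [w, Finset.prod_mul_distrib]
    _ ≤ C ^ n * ((16 : ℝ) ^ s * (n : ℝ) ^ (-s)) ^ n * Real.sqrt (Nat.log 2 n + 1) ^ n := by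
        gcongr
        exact prod_four_div_rpow_le hn hs
    _ = _ := by ring

theorem le_biSup_of_forall_le {α : Type*} {K : Set α} {u : α → ℝ} {M : ℝ} (hM0 : 0 ≤ M)
    (hM : ∀ g ∈ K, u g ≤ M) {g : α} (hg : g ∈ K) : u g ≤ ⨆ g ∈ K, u g := by
  refine le_ciSup_of_le ⟨M, ?_⟩ g (by rw [ciSup_pos hg])
  rintro _ ⟨h, rfl⟩
  exact Real.iSup_le (hM h) hM0

theorem infDist_submodule_le_norm {X : Type*} [NormedAddCommGroup X] [NormedSpace ℝ X] (g : X)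
    (L : Submodule ℝ X) : Metric.infDist g (L : Set X) ≤ ‖g‖ := by
  simpa using Metric.infDist_le_dist_of_mem (x := g) L.zero_mem

theorem exists_approx_of_kolWidth_lt {X : Type*} [NormedAddCommGroup X] [NormedSpace ℝ X]
    {K : Set X} (hK : Bornology.IsBounded K) {m : ℕ} (hm : 1 ≤ m)
    (hne : ∃ L : Submodule ℝ X, Module.finrank ℝ L = m) {c : ℝ} (hc : kolWidth K m < c) :
    ∃ ξ : ℕ → X, ∀ g ∈ K, ∃ l ∈ Submodule.span ℝ (ξ '' Set.Iio m), ‖g - l‖ ≤ c := by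
  obtain ⟨m, rfl⟩ := Nat.exists_eq_succ_of_ne_zero (by omega : m ≠ 0)
  obtain ⟨L₀, hL₀⟩ := hne
  have : Nonempty {L : Submodule ℝ X // Module.finrank ℝ L = m + 1} := ⟨⟨L₀, hL₀⟩⟩
  obtain ⟨⟨L, hL⟩, hLc⟩ := exists_lt_of_ciInf_lt hc
  obtain ⟨M, hM0, hM⟩ := hK.exists_pos_norm_le
  have : FiniteDimensional ℝ L := Module.finite_of_finrank_pos (by omega)
  let b : Module.Basis (Fin (m + 1)) ℝ L := Module.finBasisOfFinrankEq ℝ L hL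
  refine ⟨fun r => if h : r < m + 1 then b ⟨r, h⟩ else 0, fun g hg => ?_⟩
  have hlt : Metric.infDist g (L : Set X) < c := lt_of_le_of_lt
    (le_biSup_of_forall_le (u := fun g => Metric.infDist g (L : Set X)) hM0.le
      (fun h hh => (infDist_submodule_le_norm h L).trans (hM h hh)) hg) hLc
  obtain ⟨l, hl, hgl⟩ := (Metric.infDist_lt_iff ⟨0, L.zero_mem⟩).1 hlt
  refine ⟨l, ?_, by rw [← dist_eq_norm]; exact hgl.le⟩
  have hsum : l = ∑ i, b.repr ⟨l, hl⟩ i • (b i : X) := by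
    have h := congrArg L.subtype (b.sum_repr ⟨l, hl⟩)
    rw [map_sum] at h
    exact h.symm
  rw [hsum]
  refine Submodule.sum_mem _ fun i _ => Submodule.smul_mem _ _ (Submodule.subset_span ⟨i, i.2, ?_⟩)
  simp [i.2]

theorem IsGreedySeq.greedyErr_antitone {X : Type*} [NormedAddCommGroup X] [NormedSpace ℝ X]
    {K : Set X} {f : ℕ → X} (hf : IsGreedySeq K f) : Antitone (greedyErr f) := fun i n hin =>
  (Metric.infDist_le_infDist_of_subset
    (Submodule.span_mono (Set.image_mono (Set.Iio_subset_Iio hin)))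
    ⟨0, (greedySpan f i).zero_mem⟩).trans ((hf i).2 (f n) (hf n).1)

theorem IsGreedySeq.greedyErr_le_norm_sub {X : Type*} [NormedAddCommGroup X] [NormedSpace ℝ X]
    {K : Set X} {f : ℕ → X} (hf : IsGreedySeq K f) {i n : ℕ} (hin : i ≤ n) {y : X}
    (hy : y ∈ greedySpan f i) : greedyErr f n ≤ ‖f i - y‖ := by
  rw [← dist_eq_norm]
  exact (hf.greedyErr_antitone hin).trans (Metric.infDist_le_dist_of_mem hy)

theorem IsGreedySeq.finrank_greedySpan {X : Type*} [NormedAddCommGroup X] [NormedSpace ℝ X]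
    {K : Set X} {f : ℕ → X} (hf : IsGreedySeq K f) {m n : ℕ} (hmn : m ≤ n)
    (hpos : 0 < greedyErr f n) : Module.finrank ℝ (greedySpan f m) = m := by
  have hli : LinearIndependent ℝ fun i : Fin m => f i :=
    linearIndependent_of_notMem_span_image_Iio f fun i hi hmem => by
      have := hf.greedyErr_le_norm_sub (hi.le.trans hmn) hmem
      rw [sub_self, norm_zero] at this
      linarith
  have hrange : f '' Set.Iio m = Set.range fun i : Fin m => f i := by
    ext y
    constructor
    · rintro ⟨i, hi, rfl⟩
      exact ⟨⟨i, hi⟩, rfl⟩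
    · rintro ⟨i, rfl⟩
      exact ⟨i, i.2, rfl⟩
  rw [greedySpan, hrange]
  simpa using finrank_span_eq_card hli

theorem IsGreedySeq.greedyErr_le_of_lt {X : Type*} [NormedAddCommGroup X] [NormedSpace ℝ X]
    {K : Set X} (hK : Bornology.IsBounded K) {f : ℕ → X} (hf : IsGreedySeq K f) {n : ℕ}
    (hn : 1 ≤ n) {C G s : ℝ} (hC : 0 < C) (hs : 0 ≤ s)
    (hd0 : kolWidth K 0 ≤ C) (hd : ∀ k : ℕ, kolWidth K (2 ^ k) < C * (2 ^ k : ℝ) ^ (-s))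
    (hG : ∀ m : ℕ, 1 ≤ m → m ≤ 2 * n → gammaBM X m < G) (hpos : 0 < greedyErr f n) :
    greedyErr f n ≤ C * G * (16 : ℝ) ^ s * Real.sqrt (Nat.log 2 n + 1) * (n : ℝ) ^ (-s) := by
  classical
  have hξ : ∀ k : ℕ, ∃ ξ : ℕ → X, 2 ^ (k + 1) ≤ n → ∀ g ∈ K,
      ∃ l ∈ Submodule.span ℝ (ξ '' Set.Iio (2 ^ k)), ‖g - l‖ ≤ C * (2 ^ k : ℝ) ^ (-s) := by
    intro k
    by_cases hk : 2 ^ (k + 1) ≤ n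
    · have hkn : 2 ^ k ≤ n := (Nat.pow_le_pow_right (by norm_num) k.le_succ).trans hk
      obtain ⟨ξ, hξ⟩ := exists_approx_of_kolWidth_lt hK Nat.one_le_two_pow
        ⟨_, hf.finrank_greedySpan hkn hpos⟩ (hd k)
      exact ⟨ξ, fun _ => hξ⟩
    · exact ⟨0, fun h => absurd h hk⟩
  choose ξ hξ using hξ
  let S : Finset X := (Finset.range n).image f ∪
    (Finset.range (Nat.log 2 n)).biUnion fun k => (Finset.range (2 ^ k)).image (ξ k)
  let W : Submodule ℝ X := Submodule.span ℝ (S : Set X)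
  have hScard : S.card ≤ 2 * n := by
    have h1 : ((Finset.range n).image f).card ≤ n := by
      simpa using Finset.card_image_le (s := Finset.range n) (f := f)
    have h2 : ((Finset.range (Nat.log 2 n)).biUnion fun k =>
        (Finset.range (2 ^ k)).image (ξ k)).card ≤ n := by
      calc _ ≤ ∑ k ∈ Finset.range (Nat.log 2 n), 2 ^ k :=
            Finset.card_biUnion_le.trans (Finset.sum_le_sum fun k _ => by
              simpa using Finset.card_image_le (s := Finset.range (2 ^ k)) (f := ξ k))
        _ ≤ 2 ^ Nat.log 2 n := (Nat.geomSum_lt le_rfl fun k hk => Finset.mem_range.1 hk).le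
        _ ≤ n := Nat.pow_log_le_self 2 (by omega)
    exact (Finset.card_union_le _ _).trans (by omega)
  have hfW : ∀ i ≤ n, greedySpan f i ≤ W := fun i hi => by
    refine Submodule.span_mono ?_
    rintro _ ⟨j, hj, rfl⟩
    have : j < n := lt_of_lt_of_le hj hi
    exact Finset.mem_union_left _ (Finset.mem_image_of_mem f (Finset.mem_range.2 this))
  have hfi : ∀ i < n, f i ∈ W := fun i hi =>
    hfW n le_rfl (Submodule.subset_span ⟨i, hi, rfl⟩)
  have hξW : ∀ k, 2 ^ (k + 1) ≤ n → Submodule.span ℝ (ξ k '' Set.Iio (2 ^ k)) ≤ W := by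
    intro k hk
    refine Submodule.span_mono ?_
    rintro _ ⟨r, hr, rfl⟩
    have hk : k < Nat.log 2 n := Nat.le_log_of_pow_le (by norm_num) hk
    exact Finset.mem_union_right _ (Finset.mem_biUnion.2 ⟨k, Finset.mem_range.2 hk,
      Finset.mem_image_of_mem _ (Finset.mem_range.2 hr)⟩)
  have : FiniteDimensional ℝ W := FiniteDimensional.span_finset ℝ S
  have hWle : Module.finrank ℝ W ≤ 2 * n := (finrank_span_finset_le_card S).trans hScard
  have hWge : n ≤ Module.finrank ℝ W := by
    conv_lhs => rw [← hf.finrank_greedySpan le_rfl hpos]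
    exact Submodule.finrank_mono (hfW n le_rfl)
  obtain ⟨T, hT⟩ := exists_continuousLinearEquiv_of_bmDist_lt rfl
    ((bmDist_le_gammaBM (hn.trans hWge) W rfl).trans_lt (hG _ (hn.trans hWge) hWle))
  set A := ‖(T : W →L[ℝ] EuclideanSpace ℝ (Fin (Module.finrank ℝ W)))‖
  set B := ‖(T.symm : EuclideanSpace ℝ (Fin (Module.finrank ℝ W)) →L[ℝ] W)‖
  obtain ⟨Φ, hΦ⟩ := LinearMap.exists_extend T.toLinearEquiv.toLinearMap
  have hΦT : ∀ z (hz : z ∈ W), Φ z = T ⟨z, hz⟩ := fun z hz => LinearMap.congr_fun hΦ ⟨z, hz⟩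
  have hΦA : ∀ z ∈ W, ‖Φ z‖ ≤ A * ‖z‖ := fun z hz => by
    rw [hΦT z hz]
    exact (T : W →L[ℝ] EuclideanSpace ℝ (Fin (Module.finrank ℝ W))).le_opNorm ⟨z, hz⟩
  have hΦB : ∀ z ∈ W, ‖z‖ ≤ B * ‖Φ z‖ := fun z hz => by
    rw [hΦT z hz]
    simpa using (T.symm : EuclideanSpace ℝ (Fin (Module.finrank ℝ W)) →L[ℝ] W).le_opNorm (T ⟨z, hz⟩)
  have hf0 : 0 < ‖f 0‖ := hpos.trans_le
    (by simpa using hf.greedyErr_le_norm_sub n.zero_le (greedySpan f 0).zero_mem)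
  have hB : 0 < B := pos_of_mul_pos_left (hf0.trans_le (hΦB _ (hfi 0 hn))) (norm_nonneg _)
  have hA : 0 < A := by
    refine pos_of_mul_pos_left (lt_of_lt_of_le ?_ (hΦA _ (hfi 0 hn))) (norm_nonneg _)
    exact pos_of_mul_pos_right (hf0.trans_le (hΦB _ (hfi 0 hn))) hB.le
  have hspan : ∀ (g : ℕ → X) (m : ℕ), Submodule.span ℝ ((fun i => Φ (g i)) '' Set.Iio m) =
      (Submodule.span ℝ (g '' Set.Iio m)).map Φ := fun g m => by
    rw [Submodule.map_span, ← Set.image_comp]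
    rfl
  have hmain := le_of_dyadic_approx hn (fun i => Φ (f i)) (fun k r => Φ (ξ k r))
    (a := greedyErr f n / B) (C := A * C) (s := s) (by positivity) (by positivity) hs
    (fun i hi y hy => by
      rw [hspan] at hy
      obtain ⟨y, hy, rfl⟩ := hy
      rw [div_le_iff₀' hB, ← map_sub]
      exact (hf.greedyErr_le_norm_sub hi.le hy).trans
        (hΦB _ (W.sub_mem (hfi i hi) (hfW i hi.le hy))))
    (fun i hi => by
      refine (hΦA _ (hfi i hi)).trans (mul_le_mul_of_nonneg_left ?_ hA.le)
      obtain ⟨M, hM0, hM⟩ := hK.exists_pos_norm_le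
      exact (le_biSup_of_forall_le (u := fun g : X => ‖g‖) hM0.le hM (hf i).1).trans hd0)
    (fun k hk i hi => by
      obtain ⟨l, hl, hfl⟩ := hξ k hk (f i) (hf i).1
      refine ⟨Φ l, ?_, ?_⟩
      · rw [hspan]
        exact Submodule.mem_map_of_mem hl
      · rw [← map_sub, mul_assoc]
        exact (hΦA _ (W.sub_mem (hfi i hi) (hξW k hk hl))).trans
          (mul_le_mul_of_nonneg_left hfl hA.le))
  rw [div_le_iff₀ hB] at hmain
  calc greedyErr f n
      ≤ C * (A * B) * (16 : ℝ) ^ s * Real.sqrt (Nat.log 2 n + 1) * (n : ℝ) ^ (-s) :=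
        hmain.trans_eq (by ring)
    _ ≤ _ := by gcongr

theorem greedy_rate_of_kolmogorov_and_gamma
    {X : Type*} [NormedAddCommGroup X] [NormedSpace ℝ X] [CompleteSpace X]
    (K : Set X) (hKc : IsCompact K) (hKne : K.Nonempty)
    (C0 C1 s μ : ℝ) (hC0 : 0 < C0) (hC1 : 1 ≤ C1)
    (hμ0 : 0 ≤ μ) (hμ : μ ≤ 1 / 2) (hs : μ < s)
    (hd : ∀ n : ℕ, kolWidth K n ≤ C0 * (max 1 (n : ℝ)) ^ (-s))
    (hγ : ∀ n : ℕ, 1 ≤ n → gammaBM X n ≤ C1 * (n : ℝ) ^ μ) :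
    ∀ f : ℕ → X, IsGreedySeq K f → ∀ n : ℕ, 2 ≤ n →
      greedyErr f n ≤ C0 * C1 * (2 : ℝ) ^ μ * (16 : ℝ) ^ s *
        Real.sqrt (Real.logb 2 (2 * n)) * (n : ℝ) ^ (-s + μ) := by
  intro f hf n hn
  have hn0 : (0 : ℝ) < n := by exact_mod_cast (by omega : 0 < n)
  have hs0 : 0 ≤ s := hμ0.trans hs.le
  rcases le_or_gt (greedyErr f n) 0 with hle | hpos
  · exact hle.trans (by positivity)
  set G := C1 * (2 * n : ℝ) ^ μ
  set Q := (16 : ℝ) ^ s * Real.sqrt (Nat.log 2 n + 1) * (n : ℝ) ^ (-s)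
  have hG0 : 0 < G := by positivity
  have hc : ∀ c : ℝ, 1 < c → greedyErr f n ≤ c * C0 * (c * G) * Q := by
    intro c hc
    have hc0 : 0 < c := by linarith
    have hCc : C0 < c * C0 := lt_mul_of_one_lt_left hC0 hc
    refine (hf.greedyErr_le_of_lt hKc.isBounded (n := n) (C := c * C0) (G := c * G) (by omega)
      (by positivity) hs0 ?_ ?_ ?_ hpos).trans_eq (by ring)
    · have := hd 0
      simp only [Nat.cast_zero, zero_le_one, max_eq_left, Real.one_rpow, mul_one] at this
      exact this.trans hCc.le
    · intro k
      refine (hd (2 ^ k)).trans_lt ?_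
      have h1 : (1 : ℝ) ≤ 2 ^ k := one_le_pow₀ (by norm_num)
      push_cast
      rw [max_eq_right h1]
      gcongr
    · intro m hm hmn
      refine (hγ m hm).trans_lt (lt_of_le_of_lt ?_ (lt_mul_of_one_lt_left hG0 hc))
      have : (m : ℝ) ≤ 2 * n := by exact_mod_cast hmn
      simp only [G]
      gcongr
  have hlim : greedyErr f n ≤ C0 * G * Q := by
    have hcont : Filter.Tendsto (fun c : ℝ => c * C0 * (c * G) * Q) (nhdsWithin 1 (Set.Ioi 1))
        (nhds (1 * C0 * (1 * G) * Q)) :=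
      (Continuous.tendsto (by fun_prop) 1).mono_left nhdsWithin_le_nhds
    have := ge_of_tendsto hcont (eventually_mem_nhdsWithin.mono hc)
    simpa using this
  have hlog : (Nat.log 2 n + 1 : ℝ) ≤ Real.logb 2 (2 * n) := by
    rw [Real.logb_mul (by norm_num) hn0.ne', Real.logb_self_eq_one (by norm_num), add_comm]
    have := Real.natLog_le_logb n 2
    push_cast at this
    linarith
  calc greedyErr f n ≤ C0 * G * Q := hlim
    _ ≤ C0 * G * ((16 : ℝ) ^ s * Real.sqrt (Real.logb 2 (2 * n)) * (n : ℝ) ^ (-s)) := by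
        simp only [Q]
        gcongr
    _ = _ := by
        simp only [G]
        rw [Real.mul_rpow (by norm_num) hn0.le, Real.rpow_add hn0]
        ring
end

section
/- Let X be a Banach space, E a reflexive Banach space, T : E → X a compact linear operator, and K a nonempty compact subset of X with K ⊆ T(B_E), where B_E is the closed unit ball of E. Then for every greedy sequence for K and every n ≥ 1, (∏_{k=0}^{3n−1} σ_k(K)_X)^{1/(3n)} ≤ 3e²·Γ_n(E)·Γ_n(X)·(∏_{k=0}^{n−1} d_k(T))^{1/n}. -/
open scoped BigOperators NNReal ENNReal

section InfDist

variable {X : Type*} [NormedAddCommGroup X] [NormedSpace ℝ X]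

theorem Submodule.norm_mkQL_eq_infDist (V : Submodule ℝ X) (x : X) :
    ‖V.mkQL x‖ = Metric.infDist x (V : Set X) :=
  QuotientAddGroup.norm_mk (S := V.toAddSubgroup) x

theorem exists_dual_eq_infDist (V : Submodule ℝ X) (x : X) :
    ∃ b : X →L[ℝ] ℝ, ‖b‖ ≤ 1 ∧ b x = Metric.infDist x (V : Set X) ∧ ∀ v ∈ V, b v = 0 := by
  obtain ⟨g, hg, hgx⟩ := exists_dual_vector'' ℝ (V.mkQL x)
  refine ⟨g.comp V.mkQL, ?_, ?_, ?_⟩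
  · refine ContinuousLinearMap.opNorm_le_bound _ zero_le_one fun y => ?_
    calc ‖g (V.mkQL y)‖ ≤ ‖g‖ * ‖V.mkQL y‖ := g.le_opNorm _
      _ ≤ 1 * ‖y‖ := by
        gcongr
        exact Submodule.Quotient.norm_mk_le (S := V) y
  · rw [← V.norm_mkQL_eq_infDist]
    simpa using hgx
  · intro v hv
    have : V.mkQL v = 0 := by simpa using hv
    simp [this]

theorem infDist_le_mul_norm_of_unitBall {U : Type*} [NormedAddCommGroup U] [NormedSpace ℝ U]
    (P : U →L[ℝ] X) (V : Submodule ℝ X) {δ : ℝ}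
    (h : ∀ x, ‖x‖ ≤ 1 → Metric.infDist (P x) (V : Set X) ≤ δ) (x : U) :
    Metric.infDist (P x) (V : Set X) ≤ δ * ‖x‖ := by
  have hδ : 0 ≤ δ := Metric.infDist_nonneg.trans (h 0 (by simp))
  have hop : ‖V.mkQL.comp P‖ ≤ δ := by
    refine ContinuousLinearMap.opNorm_le_of_unit_norm hδ fun y hy => ?_
    simpa only [ContinuousLinearMap.comp_apply, V.norm_mkQL_eq_infDist] using h y hy.le
  rw [← V.norm_mkQL_eq_infDist]
  exact (V.mkQL.comp P).le_of_opNorm_le hop x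

theorem infDist_comp_le {U W : Type*} [NormedAddCommGroup U] [NormedSpace ℝ U]
    [NormedAddCommGroup W] [NormedSpace ℝ W] (P : U →L[ℝ] X) (Q : X →L[ℝ] W)
    (N : Submodule ℝ X) (M : Submodule ℝ W) {δ η : ℝ} (hη : 0 ≤ η)
    (hP : ∀ x, Metric.infDist (P x) (N : Set X) ≤ δ * ‖x‖)
    (hQ : ∀ y, Metric.infDist (Q y) (M : Set W) ≤ η * ‖y‖) (x : U) :
    Metric.infDist (Q (P x)) ((N.map (Q : X →ₗ[ℝ] W) ⊔ M : Submodule ℝ W) : Set W) ≤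
      (η * δ) * ‖x‖ := by
  set S := N.map (Q : X →ₗ[ℝ] W) ⊔ M
  have key : ∀ n ∈ N, Metric.infDist (Q (P x)) (S : Set W) ≤ η * ‖P x - n‖ := by
    intro n hn
    refine le_trans ?_ (hQ (P x - n))
    rw [Metric.le_infDist ⟨0, M.zero_mem⟩]
    intro m hm
    have hmem : Q n + m ∈ S :=
      S.add_mem (Submodule.mem_sup_left ⟨n, hn, rfl⟩) (Submodule.mem_sup_right hm)
    refine (Metric.infDist_le_dist_of_mem hmem).trans_eq ?_
    rw [dist_eq_norm, dist_eq_norm, map_sub]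
    congr 1
    abel
  refine le_of_forall_pos_le_add fun ε hε => ?_
  obtain ⟨n, hn, hlt⟩ := (Metric.infDist_lt_iff (s := (N : Set X)) ⟨0, N.zero_mem⟩).1
    (lt_of_le_of_lt (hP x) (lt_add_of_pos_right (δ * ‖x‖) (div_pos hε (by positivity : 0 < η + 1))))
  rw [dist_eq_norm] at hlt
  calc _ ≤ η * ‖P x - n‖ := key n hn
    _ ≤ η * (δ * ‖x‖ + ε / (η + 1)) := by gcongr
    _ = η * δ * ‖x‖ + ε * (η / (η + 1)) := by ring
    _ ≤ η * δ * ‖x‖ + ε * 1 := by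
      gcongr
      rw [div_le_one (by positivity)]
      linarith
    _ = _ := by ring

end InfDist

section TriangularSystem

variable {U W : Type*} [NormedAddCommGroup U] [NormedSpace ℝ U]
  [NormedAddCommGroup W] [NormedSpace ℝ W]

theorem exists_near_max_infDist (P : U →L[ℝ] W) {C : ℝ} (hC : 1 < C) (V : Submodule ℝ W) :
    ∃ u : U, ‖u‖ ≤ 1 ∧ ∀ x, ‖x‖ ≤ 1 →
      Metric.infDist (P x) (V : Set W) ≤ C * Metric.infDist (P u) (V : Set W) := by
  have hbdd : BddAbove (Set.range fun x : {x : U // ‖x‖ ≤ 1} =>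
      Metric.infDist (P x.1) (V : Set W)) := by
    refine ⟨‖V.mkQL.comp P‖, ?_⟩
    rintro _ ⟨x, rfl⟩
    simp only [← V.norm_mkQL_eq_infDist]
    exact (V.mkQL.comp P).unit_le_opNorm x.1 x.2
  set s := ⨆ x : {x : U // ‖x‖ ≤ 1}, Metric.infDist (P x.1) (V : Set W) with hs
  have hle : ∀ x, ‖x‖ ≤ 1 → Metric.infDist (P x) (V : Set W) ≤ s := fun x hx =>
    le_ciSup hbdd ⟨x, hx⟩
  have hC0 : 0 < C := zero_lt_one.trans hC
  rcases (Metric.infDist_nonneg.trans (hle 0 (by simp))).eq_or_lt with h0 | hpos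
  · refine ⟨0, by simp, fun x hx => (hle x hx).trans ?_⟩
    rw [← h0]
    exact mul_nonneg hC0.le Metric.infDist_nonneg
  · have : Nonempty {x : U // ‖x‖ ≤ 1} := ⟨⟨0, by simp⟩⟩
    obtain ⟨u, hu⟩ := exists_lt_of_lt_ciSup (div_lt_self hpos hC)
    refine ⟨u.1, u.2, fun x hx => (hle x hx).trans ?_⟩
    rw [div_lt_iff₀ hC0] at hu
    linarith

/-- A bounded operator admits, up to a factor `C > 1`, a triangular system of vectors and
functionals whose diagonal controls its Kolmogorov widths. -/
theorem exists_triangular_system (P : U →L[ℝ] W) {C : ℝ} (hC : 1 < C) :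
    ∃ (u : ℕ → U) (φ : ℕ → W →L[ℝ] ℝ) (V : ℕ → Submodule ℝ W),
      (∀ k, ‖u k‖ ≤ 1) ∧ (∀ k, ‖φ k‖ ≤ 1) ∧ (∀ j k, j < k → φ k (P (u j)) = 0) ∧
      (∀ k, 0 ≤ φ k (P (u k))) ∧ (∀ k, FiniteDimensional ℝ (V k)) ∧
      (∀ k, Module.finrank ℝ (V k) ≤ k) ∧
      ∀ k x, Metric.infDist (P x) (V k : Set W) ≤ C * φ k (P (u k)) * ‖x‖ := by
  choose g hg1 hg2 using exists_near_max_infDist P hC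
  choose ψ hψ1 hψ2 hψ3 using exists_dual_eq_infDist (X := W)
  obtain ⟨V, hV0, hV⟩ : ∃ V : ℕ → Submodule ℝ W,
      V 0 = ⊥ ∧ ∀ k, V (k + 1) = V k ⊔ Submodule.span ℝ {P (g (V k))} :=
    ⟨fun k => Nat.rec ⊥ (fun _ S => S ⊔ Submodule.span ℝ {P (g S)}) k, rfl, fun _ => rfl⟩
  have hmono : Monotone V := monotone_nat_of_le_succ fun k => by rw [hV]; exact le_sup_left
  have hfin : ∀ k, FiniteDimensional ℝ (V k) := fun k => by
    induction k with
    | zero => rw [hV0]; infer_instance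
    | succ k ih => rw [hV]; infer_instance
  have hrank : ∀ k, Module.finrank ℝ (V k) ≤ k := fun k => by
    induction k with
    | zero => simp [hV0]
    | succ k ih =>
      rw [hV]
      refine (Submodule.finrank_add_le_finrank_add_finrank _ _).trans ?_
      have := finrank_span_le_card (R := ℝ) {P (g (V k))}
      rw [Set.toFinset_singleton, Finset.card_singleton] at this
      omega
  refine ⟨fun k => g (V k), fun k => ψ (V k) (P (g (V k))), V, fun k => hg1 _, fun k => hψ1 _ _,
    fun j k hjk => ?_, fun k => ?_, hfin, hrank, fun k x => ?_⟩
  · refine hψ3 _ _ _ (hmono (Nat.succ_le_of_lt hjk) ?_)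
    rw [hV]
    exact Submodule.mem_sup_right (Submodule.mem_span_singleton_self _)
  · rw [hψ2]
    exact Metric.infDist_nonneg
  · rw [hψ2]
    exact infDist_le_mul_norm_of_unitBall P _ (hg2 _) x

end TriangularSystem

theorem det_of_triangular_pairing {U W : Type*} [NormedAddCommGroup U] [NormedSpace ℝ U]
    [NormedAddCommGroup W] [NormedSpace ℝ W] (P : U →L[ℝ] W) (u : ℕ → U) (φ : ℕ → W →L[ℝ] ℝ)
    (h : ∀ j k, j < k → φ k (P (u j)) = 0) (n : ℕ) :
    Matrix.det (Matrix.of fun i j : Fin n => φ j (P (u i))) =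
      ∏ k ∈ Finset.range n, φ k (P (u k)) := by
  have ht : (Matrix.of fun i j : Fin n => φ j (P (u i))).IsLowerTriangular :=
    fun i j hij => h i j hij
  rw [Matrix.det_of_isLowerTriangular _ ht]
  exact Fin.prod_univ_eq_prod_range (fun k => φ k (P (u k))) n

section Grothendieck

variable {X Y : Type*} [NormedAddCommGroup X] [NormedSpace ℝ X]
  [NormedAddCommGroup Y] [NormedSpace ℝ Y]

theorem grothOp_nonneg (T : X →L[ℝ] Y) (n : ℕ) : 0 ≤ grothOp T n :=
  Real.iSup_nonneg fun _ => Real.rpow_nonneg (abs_nonneg _) _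

theorem abs_det_le_grothOp_pow (T : X →L[ℝ] Y) {n : ℕ} (hn : n ≠ 0) (x : Fin n → X)
    (b : Fin n → Y →L[ℝ] ℝ) (hx : ∀ i, ‖x i‖ ≤ 1) (hb : ∀ j, ‖b j‖ ≤ 1) :
    |Matrix.det (Matrix.of fun i j => b j (T (x i)))| ≤ grothOp T n ^ n := by
  have hbdd : BddAbove (Set.range fun p : (Fin n → {x : X // ‖x‖ ≤ 1}) ×
      (Fin n → {b : Y →L[ℝ] ℝ // ‖b‖ ≤ 1}) =>
      |Matrix.det (Matrix.of fun i j => (p.2 j).1 (T (p.1 i).1))| ^ ((1 : ℝ) / n)) := by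
    refine ⟨(n.factorial • ‖T‖ ^ n) ^ ((1 : ℝ) / n), ?_⟩
    rintro _ ⟨p, rfl⟩
    refine Real.rpow_le_rpow (abs_nonneg _) ?_ (by positivity)
    have := Matrix.det_le (abv := AbsoluteValue.abs) (x := ‖T‖)
      (A := Matrix.of fun i j => (p.2 j).1 (T (p.1 i).1)) fun i j => ?_
    · simpa using this
    · calc |(p.2 j).1 (T (p.1 i).1)| ≤ ‖(p.2 j).1‖ * ‖T (p.1 i).1‖ := (p.2 j).1.le_opNorm _
        _ ≤ 1 * ‖T‖ := by
          gcongr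
          · exact (p.2 j).2
          · exact T.unit_le_opNorm _ (p.1 i).2
        _ = ‖T‖ := one_mul _
  have h := le_ciSup hbdd (fun i => ⟨x i, hx i⟩, fun j => ⟨b j, hb j⟩)
  calc _ = (|Matrix.det (Matrix.of fun i j => b j (T (x i)))| ^ ((1 : ℝ) / n)) ^ n := by
        rw [one_div, Real.rpow_inv_natCast_pow (abs_nonneg _) hn]
    _ ≤ _ := pow_le_pow_left₀ (Real.rpow_nonneg (abs_nonneg _) _) h n

end Grothendieck

section CauchyBinet

open Finset Matrix

theorem Matrix.det_mul_eq_sum_det_submatrix {n m : ℕ} (A : Matrix (Fin n) (Fin m) ℝ)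
    (B : Matrix (Fin m) (Fin n) ℝ) :
    (A * B).det = ∑ l : Fin n → Fin m, (∏ i, A i (l i)) * (B.submatrix l id).det := by
  have h : A * B = Matrix.of fun i => ∑ l, A i l • B l := by
    ext i j
    simp [Matrix.mul_apply, Finset.sum_apply]
  have h2 := (Matrix.detRowAlternating (n := Fin n) (R := ℝ)).toMultilinearMap.map_sum
    (fun (i : Fin n) (l : Fin m) => A i l • B l)
  rw [h]
  refine h2.trans (sum_congr rfl fun l _ => ?_)
  have h3 := (Matrix.detRowAlternating (n := Fin n) (R := ℝ)).toMultilinearMap.map_smul_univ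
    (fun i => A i (l i)) (fun i => B (l i))
  exact h3

/-- The Cauchy–Binet formula, summed over all index maps instead of increasing ones. -/
theorem Matrix.factorial_mul_det_mul {n m : ℕ} (A : Matrix (Fin n) (Fin m) ℝ)
    (B : Matrix (Fin m) (Fin n) ℝ) :
    (n.factorial : ℝ) * (A * B).det =
      ∑ l : Fin n → Fin m, (A.submatrix id l).det * (B.submatrix l id).det := by
  have hperm : ∀ τ : Equiv.Perm (Fin n), (A * B).det =
      ∑ l : Fin n → Fin m,
        ((Equiv.Perm.sign τ : ℤ) : ℝ) * (∏ i, A (τ i) (l i)) * (B.submatrix l id).det := by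
    intro τ
    rw [Matrix.det_mul_eq_sum_det_submatrix,
      ← Equiv.sum_comp (Equiv.arrowCongr τ (Equiv.refl (Fin m)))]
    refine sum_congr rfl fun l _ => ?_
    have h1 : ∏ i, A i ((Equiv.arrowCongr τ (Equiv.refl (Fin m))) l i) = ∏ i, A (τ i) (l i) := by
      rw [← Equiv.prod_comp τ]
      simp
    have h2 : B.submatrix ((Equiv.arrowCongr τ (Equiv.refl (Fin m))) l) id =
        (B.submatrix l id).submatrix τ.symm id := by
      ext i j
      simp
    rw [h1, h2, Matrix.det_permute, Equiv.Perm.sign_symm]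
    ring
  calc (n.factorial : ℝ) * (A * B).det = ∑ _τ : Equiv.Perm (Fin n), (A * B).det := by
        simp [Fintype.card_perm]
    _ = ∑ τ : Equiv.Perm (Fin n), ∑ l : Fin n → Fin m,
        ((Equiv.Perm.sign τ : ℤ) : ℝ) * (∏ i, A (τ i) (l i)) * (B.submatrix l id).det :=
      sum_congr rfl fun τ _ => hperm τ
    _ = _ := by
      rw [sum_comm]
      refine sum_congr rfl fun l _ => ?_
      rw [← sum_mul, Matrix.det_apply' (A.submatrix id l)]
      rfl

theorem Matrix.PosSemidef.det_le_one_of_diag_le_one {n : ℕ} {G : Matrix (Fin n) (Fin n) ℝ}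
    (hG : G.PosSemidef) (hdiag : ∀ i, G i i ≤ 1) : G.det ≤ 1 := by
  rcases Nat.eq_zero_or_pos n with rfl | hn
  · simp
  have hn' : (0 : ℝ) < n := by exact_mod_cast hn
  have hev := hG.eigenvalues_nonneg
  have htr : ∑ i, hG.1.eigenvalues i ≤ n := by
    have h := hG.1.trace_eq_sum_eigenvalues
    have h2 : G.trace ≤ n := by
      calc G.trace = ∑ i, G i i := rfl
        _ ≤ ∑ _i : Fin n, (1 : ℝ) := sum_le_sum fun i _ => hdiag i
        _ = n := by simp
    simpa [h] using h2
  have hdet : G.det = ∏ i, hG.1.eigenvalues i := by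
    simpa using hG.1.det_eq_prod_eigenvalues
  have hgm := Real.geom_mean_le_arith_mean univ (fun _ => (1 : ℝ)) hG.1.eigenvalues
    (fun _ _ => zero_le_one) (by simpa using hn) (fun i _ => hev i)
  simp only [Real.rpow_one, sum_const, card_univ, Fintype.card_fin, nsmul_eq_mul, mul_one,
    one_mul] at hgm
  rw [← hdet] at hgm
  have h1 : G.det ^ ((n : ℝ)⁻¹) ≤ 1 := hgm.trans ((div_le_one hn').2 htr)
  by_contra! hlt
  exact absurd h1 (not_le.2 (Real.one_lt_rpow hlt (by positivity)))

theorem Matrix.abs_det_mul_le {n m : ℕ} (Z : Matrix (Fin n) (Fin m) ℝ)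
    (hZ : ∀ i, ∑ l, Z i l ^ 2 ≤ 1) (B : Matrix (Fin m) (Fin n) ℝ) {G : ℝ}
    (hG : 0 ≤ G) (hB : ∀ l : Fin n → Fin m, |(B.submatrix l id).det| ≤ G) :
    |(Z * B).det| ≤ G * √((m : ℝ) ^ n / n.factorial) := by
  have hfact : (0 : ℝ) < n.factorial := by exact_mod_cast n.factorial_pos
  have hgram : ∑ l : Fin n → Fin m, (Z.submatrix id l).det ^ 2 ≤ n.factorial := by
    have h := Matrix.factorial_mul_det_mul Z Zᵀ
    have h1 : (Z * Zᵀ).det ≤ 1 := by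
      refine Matrix.PosSemidef.det_le_one_of_diag_le_one ?_ fun i => ?_
      · simpa using Matrix.posSemidef_self_mul_conjTranspose Z
      · simpa [Matrix.mul_apply, sq] using hZ i
    calc _ = (n.factorial : ℝ) * (Z * Zᵀ).det := by
          rw [h]
          refine sum_congr rfl fun l _ => ?_
          rw [← Matrix.transpose_submatrix, Matrix.det_transpose, sq]
      _ ≤ n.factorial * 1 := by gcongr
      _ = _ := mul_one _
  have hsum : ∑ l : Fin n → Fin m, |(Z.submatrix id l).det| ≤ √((m : ℝ) ^ n * n.factorial) := by
    refine Real.le_sqrt_of_sq_le ?_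
    calc _ ≤ (#(univ : Finset (Fin n → Fin m)) : ℝ) *
          ∑ l : Fin n → Fin m, |(Z.submatrix id l).det| ^ 2 := sq_sum_le_card_mul_sum_sq
      _ ≤ (m : ℝ) ^ n * n.factorial := by
        simp only [sq_abs]
        simp only [card_univ, Fintype.card_pi, Fintype.card_fin, prod_const, Nat.cast_pow]
        gcongr
  have hmain : (n.factorial : ℝ) * |(Z * B).det| ≤ G * √((m : ℝ) ^ n * n.factorial) := by
    calc _ = |(n.factorial : ℝ) * (Z * B).det| := by rw [abs_mul, abs_of_pos hfact]
      _ = |∑ l : Fin n → Fin m, (Z.submatrix id l).det * (B.submatrix l id).det| := by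
        rw [Matrix.factorial_mul_det_mul]
      _ ≤ ∑ l : Fin n → Fin m, |(Z.submatrix id l).det| * G := by
        refine (abs_sum_le_sum_abs _ _).trans (sum_le_sum fun l _ => ?_)
        rw [abs_mul]
        gcongr
        exact hB l
      _ ≤ _ := by
        rw [← sum_mul, mul_comm]
        gcongr
  have hsq : √((m : ℝ) ^ n * n.factorial) = n.factorial * √((m : ℝ) ^ n / n.factorial) := by
    rw [show (m : ℝ) ^ n * n.factorial = (n.factorial : ℝ) ^ 2 * ((m : ℝ) ^ n / n.factorial) by
      field_simp, Real.sqrt_mul (by positivity), Real.sqrt_sq hfact.le]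
  rw [hsq] at hmain
  refine le_of_mul_le_mul_left (hmain.trans_eq ?_) hfact
  ring

theorem sqrt_three_mul_pow_div_factorial_le (n : ℕ) :
    √(((3 * n : ℕ) : ℝ) ^ n / n.factorial) ≤ √((3 * Real.exp 1) ^ n) := by
  refine Real.sqrt_le_sqrt ?_
  have h := Real.pow_div_factorial_le_exp (x := (n : ℝ)) (by positivity) n
  have h2 : Real.exp n = Real.exp 1 ^ n := by rw [← Real.exp_nat_mul, mul_one]
  push_cast
  rw [mul_pow, mul_pow, mul_div_assoc, ← h2]
  gcongr

end CauchyBinet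

section SingularValues

open Module InnerProductSpace

theorem LinearMap.singularValues_le_of_infDist_le {H : Type*} [NormedAddCommGroup H]
    [InnerProductSpace ℝ H] [FiniteDimensional ℝ H] (D : H →ₗ[ℝ] H) (N : Submodule ℝ H) {δ : ℝ}
    (hδ : 0 ≤ δ) (h : ∀ x, Metric.infDist (D x) (N : Set H) ≤ δ * ‖x‖) {j : ℕ}
    (hj : finrank ℝ N ≤ j) : D.singularValues j ≤ δ := by
  rcases le_or_gt (finrank ℝ H) j with hlt | hlt
  · rwa [D.singularValues_of_finrank_le hlt]
  set S := D.isSymmetric_adjoint_comp_self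
  set e := S.eigenvectorBasis (rfl : finrank ℝ H = _)
  let v : Fin (j + 1) → H := fun i => e (Fin.castLE hlt i)
  have hv : Orthonormal ℝ v := e.orthonormal.comp _ (Fin.castLE_injective hlt)
  let L : (Fin (j + 1) → ℝ) →ₗ[ℝ] H := Fintype.linearCombination ℝ v
  have hL : ∀ c, L c = ∑ i, c i • v i := fun c => Fintype.linearCombination_apply ℝ v c
  have hker : LinearMap.ker (N.orthogonalProjectionOnto.toLinearMap ∘ₗ D ∘ₗ L) ≠ ⊥ := by
    refine LinearMap.ker_ne_bot_of_finrank_lt ?_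
    simpa using Nat.lt_succ_of_le hj
  obtain ⟨c, hc, hc0⟩ := (Submodule.ne_bot_iff _).1 hker
  have horth : D (L c) ∈ Nᗮ := by
    rw [← Submodule.orthogonalProjectionOnto_eq_zero_iff]
    simpa using hc
  have hnorm : ‖D (L c)‖ ≤ δ * ‖L c‖ := by
    refine le_trans ?_ (h (L c))
    rw [Metric.le_infDist ⟨0, N.zero_mem⟩]
    intro y hy
    have hin : ⟪D (L c), y⟫_ℝ = 0 := Submodule.inner_left_of_mem_orthogonal hy horth
    have hpy := norm_sub_sq_eq_norm_sq_add_norm_sq_real hin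
    rw [dist_eq_norm]
    nlinarith [norm_nonneg (D (L c)), norm_nonneg (D (L c) - y), mul_self_nonneg ‖y‖]
  have hsq : ‖L c‖ ^ 2 = ∑ i, c i ^ 2 := by
    rw [← real_inner_self_eq_norm_sq, hL, hv.inner_sum]
    simp [sq]
  have hDL : ‖D (L c)‖ ^ 2 = ∑ i : Fin (j + 1), D.singularValues i ^ 2 * c i ^ 2 := by
    have h1 : (D.adjoint ∘ₗ D) (L c) = ∑ i : Fin (j + 1), (D.singularValues i ^ 2 * c i) • v i := by
      rw [hL, map_sum]
      refine Finset.sum_congr rfl fun i _ => ?_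
      rw [map_smul]
      have h2 := S.apply_eigenvectorBasis (rfl : finrank ℝ H = _) (Fin.castLE hlt i)
      have h3 := D.sq_singularValues_fin (rfl : finrank ℝ H = _) (Fin.castLE hlt i)
      rw [Fin.val_castLE] at h3
      change c i • (D.adjoint ∘ₗ D) (S.eigenvectorBasis rfl (Fin.castLE hlt i)) = _
      rw [h2, ← h3, smul_smul, mul_comm]
      rfl
    rw [← real_inner_self_eq_norm_sq, ← LinearMap.adjoint_inner_left]
    change ⟪(D.adjoint ∘ₗ D) (L c), L c⟫_ℝ = _
    rw [h1, hL, hv.inner_sum]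
    refine Finset.sum_congr rfl fun i _ => ?_
    simp only [conj_trivial]
    ring
  have hlow : D.singularValues j ^ 2 * ‖L c‖ ^ 2 ≤ ‖D (L c)‖ ^ 2 := by
    rw [hsq, hDL, Finset.mul_sum]
    refine Finset.sum_le_sum fun i _ => ?_
    gcongr
    · exact D.singularValues_nonneg _
    · exact D.singularValues_antitone (Nat.le_of_lt_succ i.2)
  have hpos : 0 < ‖L c‖ ^ 2 := by
    rw [hsq]
    obtain ⟨i, hi⟩ := Function.ne_iff.1 hc0
    exact Finset.sum_pos' (fun i _ => sq_nonneg _) ⟨i, Finset.mem_univ i, by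
      have : c i ≠ 0 := hi
      positivity⟩
  have hup : ‖D (L c)‖ ^ 2 ≤ δ ^ 2 * ‖L c‖ ^ 2 := by
    rw [← mul_pow]
    gcongr
  exact abs_le_of_sq_le_sq' (le_of_mul_le_mul_right (hlow.trans hup) hpos) hδ |>.2

end SingularValues

section KolmogorovWidth

variable {E X : Type*} [NormedAddCommGroup E] [NormedSpace ℝ E]
  [NormedAddCommGroup X] [NormedSpace ℝ X]

theorem kolWidthOp_nonneg (T : E →L[ℝ] X) (k : ℕ) : 0 ≤ kolWidthOp T k := by
  cases k with
  | zero => exact norm_nonneg T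
  | succ k => exact Real.iInf_nonneg fun _ => Real.iSup_nonneg fun _ => Metric.infDist_nonneg

theorem exists_submodule_finrank_eq_of_not_le {k : ℕ}
    (h : ¬(FiniteDimensional ℝ X ∧ Module.finrank ℝ X ≤ k)) :
    ∃ L : Submodule ℝ X, Module.finrank ℝ L = k := by
  have hk : (k : Cardinal) ≤ Module.rank ℝ X := by
    by_contra! hlt
    have hfd : FiniteDimensional ℝ X :=
      Module.rank_lt_aleph0_iff.1 (hlt.trans Cardinal.natCast_lt_aleph0)
    exact h ⟨hfd, Module.finrank_le_of_rank_le hlt.le⟩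
  obtain ⟨v, hv⟩ := Module.le_rank_iff.1 hk
  exact ⟨Submodule.span ℝ (Set.range v), by simpa using finrank_span_eq_card hv⟩

theorem exists_submodule_of_kolWidthOp_lt (T : E →L[ℝ] X) {k : ℕ} {δ : ℝ}
    (hδ : kolWidthOp T k < δ) :
    ∃ L : Submodule ℝ X, FiniteDimensional ℝ L ∧ Module.finrank ℝ L ≤ k ∧
      ∀ x, Metric.infDist (T x) (L : Set X) ≤ δ * ‖x‖ := by
  cases k with
  | zero =>
    refine ⟨⊥, inferInstance, by simp, fun x => ?_⟩
    have h : ‖T‖ ≤ δ := hδ.le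
    simpa using T.le_of_opNorm_le h x
  | succ k =>
    by_cases hX : FiniteDimensional ℝ X ∧ Module.finrank ℝ X ≤ k + 1
    · obtain ⟨hfd, hle⟩ := hX
      refine ⟨⊤, inferInstance, by simpa using hle, fun x => ?_⟩
      rw [Metric.infDist_zero_of_mem (by simp)]
      exact mul_nonneg ((kolWidthOp_nonneg T (k + 1)).trans hδ.le) (norm_nonneg x)
    · obtain ⟨L₀, hL₀⟩ := exists_submodule_finrank_eq_of_not_le hX
      have : Nonempty {L : Submodule ℝ X // Module.finrank ℝ L = k + 1} := ⟨⟨L₀, hL₀⟩⟩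
      obtain ⟨L, hL⟩ := exists_lt_of_ciInf_lt (show iInf _ < δ from hδ)
      refine ⟨L.1, Module.finite_of_finrank_pos (by rw [L.2]; positivity), L.2.le, ?_⟩
      refine infDist_le_mul_norm_of_unitBall T L.1 fun x hx => le_trans ?_ hL.le
      refine le_ciSup (f := fun x : {x : E // ‖x‖ ≤ 1} => Metric.infDist (T x.1) (L.1 : Set X))
        ⟨‖L.1.mkQL.comp T‖, ?_⟩ ⟨x, hx⟩
      rintro _ ⟨x, rfl⟩
      simp only [← L.1.norm_mkQL_eq_infDist]
      exact (L.1.mkQL.comp T).unit_le_opNorm x.1 x.2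

end KolmogorovWidth

section GreedySequence

variable {E X : Type*} [NormedAddCommGroup E] [NormedSpace ℝ E]
  [NormedAddCommGroup X] [NormedSpace ℝ X]

theorem prod_greedyErr_eq_det (f : ℕ → X) :
    ∃ b : ℕ → X →L[ℝ] ℝ, (∀ k, ‖b k‖ ≤ 1) ∧ ∀ n : ℕ,
      ∏ k ∈ Finset.range n, greedyErr f k =
        Matrix.det (Matrix.of fun i j : Fin n => b j (f i)) := by
  choose b hb1 hb2 hb3 using fun k => exists_dual_eq_infDist (greedySpan f k) (f k)
  refine ⟨b, hb1, fun n => ?_⟩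
  have ht : (Matrix.of fun i j : Fin n => b j (f i)).IsLowerTriangular := fun i j hij =>
    hb3 j (f i) (Submodule.subset_span ⟨(i : ℕ), Set.mem_Iio.2 hij, rfl⟩)
  rw [Matrix.det_of_isLowerTriangular _ ht]
  simp only [Matrix.of_apply, hb2]
  exact (Fin.prod_univ_eq_prod_range (fun k => greedyErr f k) n).symm

end GreedySequence

section Determinant

open Finset Module

variable {E X : Type*} [NormedAddCommGroup E] [NormedSpace ℝ E]
  [NormedAddCommGroup X] [NormedSpace ℝ X]

theorem prod_range_three_mul_le {s δ : ℕ → ℝ} (hs : ∀ k, 0 ≤ s k) (h : ∀ k i, 3 * k ≤ i → s i ≤ δ k)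
    (n : ℕ) : ∏ i ∈ range (3 * n), s i ≤ (∏ k ∈ range n, δ k) ^ 3 := by
  induction n with
  | zero => simp
  | succ n ih =>
    have hδ : ∀ k, 0 ≤ δ k := fun k => (hs _).trans (h k (3 * k) le_rfl)
    rw [show 3 * (n + 1) = 3 * n + 1 + 1 + 1 by ring, prod_range_succ, prod_range_succ,
      prod_range_succ, prod_range_succ, mul_pow, mul_assoc, mul_assoc, pow_three (δ n)]
    have h0 := h n (3 * n) le_rfl
    have h1 := h n (3 * n + 1) (by omega)
    have h2 := h n (3 * n + 1 + 1) (by omega)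
    have := hs (3 * n)
    have := hs (3 * n + 1)
    have := hs (3 * n + 1 + 1)
    have := hδ n
    have : 0 ≤ ∏ k ∈ range n, δ k := prod_nonneg fun k _ => hδ k
    gcongr

/-- The operator `ℓ₂ᵐ → E` sending the standard basis to the given vectors. -/
noncomputable def synthesisCLM {m : ℕ} (x : Fin m → E) : EuclideanSpace ℝ (Fin m) →L[ℝ] E :=
  ∑ i, (EuclideanSpace.proj i : EuclideanSpace ℝ (Fin m) →L[ℝ] ℝ).smulRight (x i)

/-- The operator `X → ℓ₂ᵐ` whose coordinates are the given functionals. -/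
noncomputable def analysisCLM {m : ℕ} (b : Fin m → X →L[ℝ] ℝ) : X →L[ℝ] EuclideanSpace ℝ (Fin m) :=
  (EuclideanSpace.equiv (Fin m) ℝ).symm.toContinuousLinearMap.comp (ContinuousLinearMap.pi b)

theorem synthesisCLM_apply {m : ℕ} (x : Fin m → E) (z : EuclideanSpace ℝ (Fin m)) :
    synthesisCLM x z = ∑ i, z i • x i := by
  simp [synthesisCLM]

@[simp]
theorem analysisCLM_apply {m : ℕ} (b : Fin m → X →L[ℝ] ℝ) (y : X) (i : Fin m) :
    analysisCLM b y i = b i y := rfl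

theorem abs_det_pairing_synthesisCLM_le {m n : ℕ} (hn : n ≠ 0) (x : Fin m → E)
    (hx : ∀ i, ‖x i‖ ≤ 1) (u : Fin n → EuclideanSpace ℝ (Fin m)) (hu : ∀ i, ‖u i‖ ≤ 1)
    (φ : Fin n → E →L[ℝ] ℝ) (hφ : ∀ j, ‖φ j‖ ≤ 1) :
    |Matrix.det (Matrix.of fun i j => φ j (synthesisCLM x (u i)))| ≤
      groth E n ^ n * √((m : ℝ) ^ n / n.factorial) := by
  have h : (Matrix.of fun i j => φ j (synthesisCLM x (u i))) =
      (Matrix.of fun i l => u i l) * (Matrix.of fun l j => φ j (x l)) := by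
    ext i j
    simp [synthesisCLM_apply, Matrix.mul_apply]
  rw [h]
  refine Matrix.abs_det_mul_le _ (fun i => ?_) _ (pow_nonneg (grothOp_nonneg _ n) n) fun l => ?_
  · have := EuclideanSpace.real_norm_sq_eq (u i)
    simp only [Matrix.of_apply, ← this]
    exact pow_le_one₀ (norm_nonneg _) (hu i)
  · exact abs_det_le_grothOp_pow (ContinuousLinearMap.id ℝ E) hn (fun i => x (l i)) φ
      (fun i => hx _) hφ

theorem abs_det_pairing_analysisCLM_le {m n : ℕ} (hn : n ≠ 0) (b : Fin m → X →L[ℝ] ℝ)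
    (hb : ∀ i, ‖b i‖ ≤ 1) (u : Fin n → X) (hu : ∀ i, ‖u i‖ ≤ 1)
    (φ : Fin n → EuclideanSpace ℝ (Fin m) →L[ℝ] ℝ) (hφ : ∀ j, ‖φ j‖ ≤ 1) :
    |Matrix.det (Matrix.of fun i j => φ j (analysisCLM b (u i)))| ≤
      groth X n ^ n * √((m : ℝ) ^ n / n.factorial) := by
  set y : Fin n → EuclideanSpace ℝ (Fin m) :=
    fun j => (InnerProductSpace.toDual ℝ (EuclideanSpace ℝ (Fin m))).symm (φ j)
  have hφy : ∀ j z, φ j z = ∑ l, y j l * z l := by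
    intro j z
    have h := InnerProductSpace.toDual_symm_apply (𝕜 := ℝ) (x := z) (y := φ j)
    rw [← h, PiLp.inner_apply]
    refine Finset.sum_congr rfl fun l _ => ?_
    simp [y, mul_comm]
  have h : (Matrix.of fun i j => φ j (analysisCLM b (u i))).transpose =
      (Matrix.of fun j l => y j l) * (Matrix.of fun l i => b l (u i)) := by
    ext i j
    simp [hφy, Matrix.mul_apply]
  rw [← Matrix.det_transpose, h]
  refine Matrix.abs_det_mul_le _ (fun j => ?_) _ (pow_nonneg (grothOp_nonneg _ n) n) fun l => ?_
  · have := EuclideanSpace.real_norm_sq_eq (y j)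
    simp only [Matrix.of_apply, ← this]
    refine pow_le_one₀ (norm_nonneg _) ?_
    simpa [y] using hφ j
  · rw [← Matrix.det_transpose]
    exact abs_det_le_grothOp_pow (ContinuousLinearMap.id ℝ X) hn u (fun j => b (l j)) hu
      (fun j => hb _)

theorem abs_det_le_of_kolWidthOp_lt (T : E →L[ℝ] X) {n : ℕ} (hn : n ≠ 0) {C : ℝ} (hC : 1 < C)
    (x : Fin (3 * n) → E) (hx : ∀ i, ‖x i‖ ≤ 1) (b : Fin (3 * n) → X →L[ℝ] ℝ)
    (hb : ∀ j, ‖b j‖ ≤ 1) (t : ℕ → ℝ) (ht : ∀ k, kolWidthOp T k < t k) :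
    |Matrix.det (Matrix.of fun i j => b j (T (x i)))| ≤
      ((C ^ 2 * (3 * Real.exp 1) * groth E n * groth X n) ^ n * ∏ k ∈ range n, t k) ^ 3 := by
  have hC0 : 0 < C := zero_lt_one.trans hC
  have ht0 : ∀ k, 0 ≤ t k := fun k => (kolWidthOp_nonneg T k).trans (ht k).le
  set A := synthesisCLM x with hA
  set B := analysisCLM b with hB
  obtain ⟨u, φ, V, hu, hφ, hφ0, hφpos, hVfd, hVr, hV⟩ := exists_triangular_system A hC
  obtain ⟨w, ψ, M, hw, hψ, hψ0, hψpos, hMfd, hMr, hM⟩ := exists_triangular_system B hC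
  choose L hLfd hLr hL using fun k => exists_submodule_of_kolWidthOp_lt T (ht k)
  set α : ℕ → ℝ := fun k => φ k (A (u k))
  set β : ℕ → ℝ := fun k => ψ k (B (w k))
  let D : EuclideanSpace ℝ (Fin (3 * n)) →L[ℝ] EuclideanSpace ℝ (Fin (3 * n)) := B.comp (T.comp A)
  have hdet : |Matrix.det (Matrix.of fun i j => b j (T (x i)))| =
      ∏ i ∈ range (3 * n), D.toLinearMap.singularValues i := by
    have h1 := LinearMap.normDet_eq_prod_singularValues D.toLinearMap
    rw [finrank_euclideanSpace_fin] at h1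
    rw [← h1, LinearMap.normDet_eq_norm_det_toMatrix _ (EuclideanSpace.basisFun (Fin (3 * n)) ℝ)
      (EuclideanSpace.basisFun (Fin (3 * n)) ℝ), Real.norm_eq_abs, ← Matrix.det_transpose]
    congr 2
    ext i j
    simp [LinearMap.toMatrix_apply, D, hA, hB, synthesisCLM_apply]
  have hsv : ∀ k i, 3 * k ≤ i → D.toLinearMap.singularValues i ≤
      C * β k * (t k * (C * α k)) := by
    intro k i hki
    have hα := hφpos k
    have hβ := hψpos k
    have htk := ht0 k
    have h1 := infDist_comp_le A T (V k) (L k) htk (hV k) (hL k)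
    have h2 := infDist_comp_le (T.comp A) B _ (M k) (mul_nonneg hC0.le hβ) h1 (hM k)
    have hD : ∀ z, D.toLinearMap z = B ((T.comp A) z) := fun z => rfl
    simp only [← hD] at h2
    have hδ : 0 ≤ C * β k * (t k * (C * α k)) := by positivity
    refine LinearMap.singularValues_le_of_infDist_le D.toLinearMap _ hδ h2 ?_
    refine (Submodule.finrank_add_le_finrank_add_finrank _ _).trans ?_
    have h3 := (Submodule.finrank_map_le B.toLinearMap ((V k).map (T : E →ₗ[ℝ] X) ⊔ L k)).trans
      (Submodule.finrank_add_le_finrank_add_finrank _ _)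
    have h4 := Submodule.finrank_map_le (T : E →ₗ[ℝ] X) (V k)
    have := hVr k
    have := hMr k
    have := hLr k
    omega
  have hprodα : ∏ k ∈ range n, α k ≤ groth E n ^ n * √((3 * Real.exp 1) ^ n) := by
    rw [← det_of_triangular_pairing A u φ hφ0 n]
    refine (le_abs_self _).trans ((abs_det_pairing_synthesisCLM_le hn x hx _ (fun i => hu i) _
      fun j => hφ j).trans ?_)
    exact mul_le_mul_of_nonneg_left (sqrt_three_mul_pow_div_factorial_le n)
      (pow_nonneg (grothOp_nonneg _ n) n)
  have hprodβ : ∏ k ∈ range n, β k ≤ groth X n ^ n * √((3 * Real.exp 1) ^ n) := by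
    rw [← det_of_triangular_pairing B w ψ hψ0 n]
    refine (le_abs_self _).trans ((abs_det_pairing_analysisCLM_le hn b hb _ (fun i => hw i) _
      fun j => hψ j).trans ?_)
    exact mul_le_mul_of_nonneg_left (sqrt_three_mul_pow_div_factorial_le n)
      (pow_nonneg (grothOp_nonneg _ n) n)
  rw [hdet]
  refine (prod_range_three_mul_le (fun k => LinearMap.singularValues_nonneg _ k) hsv n).trans ?_
  have hα0 : 0 ≤ ∏ k ∈ range n, α k := prod_nonneg fun k _ => hφpos k
  have hβ0 : 0 ≤ ∏ k ∈ range n, β k := prod_nonneg fun k _ => hψpos k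
  have hT0 : 0 ≤ ∏ k ∈ range n, t k := prod_nonneg fun k _ => ht0 k
  have hE0 : 0 ≤ groth E n := grothOp_nonneg _ n
  have hX0 : 0 ≤ groth X n := grothOp_nonneg _ n
  refine pow_le_pow_left₀ (prod_nonneg fun k _ => ?_) ?_ 3
  · have hα := hφpos k
    have hβ := hψpos k
    have htk := ht0 k
    positivity
  calc ∏ k ∈ range n, C * β k * (t k * (C * α k))
      = (C ^ 2) ^ n * ((∏ k ∈ range n, α k) * ∏ k ∈ range n, β k) * ∏ k ∈ range n, t k := by
        simp only [prod_mul_distrib, prod_const, card_range]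
        ring
    _ ≤ (C ^ 2) ^ n * ((groth E n ^ n * √((3 * Real.exp 1) ^ n)) *
        (groth X n ^ n * √((3 * Real.exp 1) ^ n))) * ∏ k ∈ range n, t k := by gcongr
    _ = (C ^ 2) ^ n * (groth E n ^ n * groth X n ^ n *
        (√((3 * Real.exp 1) ^ n) * √((3 * Real.exp 1) ^ n))) * ∏ k ∈ range n, t k := by ring
    _ = _ := by
      rw [Real.mul_self_sqrt (by positivity)]
      simp only [mul_pow]
      ring

end Determinant

theorem greedy_geometric_mean_bound_kolmogorov
    {X E : Type*} [NormedAddCommGroup X] [NormedSpace ℝ X] [CompleteSpace X]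
    [NormedAddCommGroup E] [NormedSpace ℝ E] [CompleteSpace E]
    (hrefl : Function.Surjective (NormedSpace.inclusionInDoubleDual ℝ E))
    (T : E →L[ℝ] X) (hT : IsCompactOperator T)
    (K : Set X) (hKc : IsCompact K) (hKne : K.Nonempty)
    (hKT : K ⊆ T '' Metric.closedBall 0 1) :
    ∀ f : ℕ → X, IsGreedySeq K f → ∀ n : ℕ, 1 ≤ n →
      (∏ k ∈ Finset.range (3 * n), greedyErr f k) ^ ((1 : ℝ) / (3 * n)) ≤
        3 * Real.exp 1 ^ 2 * groth E n * groth X n *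
          (∏ k ∈ Finset.range n, kolWidthOp T k) ^ ((1 : ℝ) / n) := by
  intro f hf n hn
  have hn0 : n ≠ 0 := by omega
  have hE0 : 0 ≤ groth E n := grothOp_nonneg _ n
  have hX0 : 0 ≤ groth X n := grothOp_nonneg _ n
  have hd0 : ∀ k, 0 ≤ kolWidthOp T k := kolWidthOp_nonneg T
  choose x hxball hxf using fun k => hKT (hf k).1
  have hx : ∀ k, ‖x k‖ ≤ 1 := fun k => by simpa using hxball k
  obtain ⟨b, hb, hdet⟩ := prod_greedyErr_eq_det f
  have hσ0 : 0 ≤ ∏ k ∈ Finset.range (3 * n), greedyErr f k :=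
    Finset.prod_nonneg fun k _ => Metric.infDist_nonneg
  have hbound : ∀ ε : ℝ, 0 < ε →
      (∏ k ∈ Finset.range (3 * n), greedyErr f k) ^ ((1 : ℝ) / (3 * n)) ≤
        3 * Real.exp 1 ^ 2 * groth E n * groth X n *
          (∏ k ∈ Finset.range n, (kolWidthOp T k + ε)) ^ ((1 : ℝ) / n) := by
    intro ε hε
    set c := (3 / 2 : ℝ) ^ 2 * (3 * Real.exp 1) * groth E n * groth X n with hc
    set p := ∏ k ∈ Finset.range n, (kolWidthOp T k + ε)
    have hc0 : 0 ≤ c := by positivity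
    have hp0 : 0 ≤ p := Finset.prod_nonneg fun k _ => add_nonneg (hd0 k) hε.le
    have hle : ∏ k ∈ Finset.range (3 * n), greedyErr f k ≤ (c ^ n * p) ^ 3 := by
      rw [hdet]
      refine (le_abs_self _).trans ?_
      simp only [← hxf]
      exact abs_det_le_of_kolWidthOp_lt T hn0 (by norm_num) _ (fun i => hx i) _ (fun j => hb j) _
        fun k => lt_add_of_pos_right _ hε
    have hroot : ((c ^ n * p) ^ 3) ^ ((1 : ℝ) / (3 * n)) = c * p ^ ((1 : ℝ) / n) := by
      have hcp : 0 ≤ c ^ n * p := by positivity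
      rw [← Real.rpow_natCast (c ^ n * p) 3, ← Real.rpow_mul hcp,
        show ((3 : ℕ) : ℝ) * (1 / (3 * n)) = 1 / n by push_cast; field_simp,
        Real.mul_rpow (by positivity) hp0, one_div, Real.pow_rpow_inv_natCast hc0 hn0]
    have hce : c ≤ 3 * Real.exp 1 ^ 2 * groth E n * groth X n := by
      have he := Real.exp_one_gt_d9
      have h1 : (3 / 2 : ℝ) ^ 2 * (3 * Real.exp 1) ≤ 3 * Real.exp 1 ^ 2 := by nlinarith
      rw [hc]
      gcongr
    calc _ ≤ ((c ^ n * p) ^ 3) ^ ((1 : ℝ) / (3 * n)) :=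
          Real.rpow_le_rpow hσ0 hle (by positivity)
      _ = c * p ^ ((1 : ℝ) / n) := hroot
      _ ≤ _ := by gcongr
  have hcont : Continuous fun ε : ℝ => 3 * Real.exp 1 ^ 2 * groth E n * groth X n *
      (∏ k ∈ Finset.range n, (kolWidthOp T k + ε)) ^ ((1 : ℝ) / n) := by
    refine continuous_const.mul (Continuous.rpow_const ?_ fun _ => Or.inr (by positivity))
    fun_prop
  have hlim := (hcont.tendsto 0).mono_left (nhdsWithin_le_nhds (s := Set.Ioi 0))
  simp only [add_zero] at hlim
  refine ge_of_tendsto hlim ?_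
  filter_upwards [self_mem_nhdsWithin] with ε hε
  exact hbound ε hε
end
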